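/- arXiv:2311.12348 — 2 statements merged into one kernel-verified Lean document; each statement's English description precedes it below -/
import Mathlib

section
/- Horizontal specialization: Let A be a ring, v : A → Γ₀ a valuation with value group Γ_v, and Δ a subgroup of Γ_v that is convex in Γ_v (if δ₁ ≤ γ ≤ δ₂ with δ₁, δ₂ ∈ Δ and γ ∈ Γ_v, then γ ∈ Δ) and contains every value v(f) with 1 ≤ v(f). Define v_Δ(f) = v(f) if v(f) is a unit lying in Δ, and v_Δ(f) = 0 otherwise. Then: (a) v_Δ is a valuation on A; (b) v_Δ lies in the closure of v in the valuation spectrum, i.e., for all g, s ∈ A, if v_Δ(g) ≤ v_Δ(s) and v_Δ(s) ≠ 0, then v(g) ≤ v(s) and v(s) ≠ 0. -/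
/-!
Statement 11 (Horizontal specialization): Let `v` be a valuation on a ring `A` and `Δ` a
convex subgroup of the value group of `v` containing every value `v f ≥ 1`. Then setting
`v_Δ f = v f` if `v f` is a unit lying in `Δ`, and `v_Δ f = 0` otherwise, defines a
valuation on `A` lying in the closure of `v` in the valuation spectrum.
-/

open Filter Topology

/-- The value group of a valuation: the subgroup of `Γ₀ˣ` generated by the nonzero values. -/
def valueGroup {A : Type*} [CommRing A] {Γ₀ : Type*} [LinearOrderedCommGroupWithZero Γ₀]
    (v : Valuation A Γ₀) : Subgroup Γ₀ˣ :=
  Subgroup.closure {γ : Γ₀ˣ | ∃ f : A, v f = (γ : Γ₀)}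

open Classical in
/-- The horizontal specialization of `v` along a subgroup `Δ` of `Γ₀ˣ`: it sends `f` to
`v f` if `v f` is a unit lying in `Δ`, and to `0` otherwise. -/
noncomputable def horizSpec {A : Type*} [CommRing A] {Γ₀ : Type*}
    [LinearOrderedCommGroupWithZero Γ₀] (v : Valuation A Γ₀) (Δ : Subgroup Γ₀ˣ)
    (f : A) : Γ₀ :=
  if ∃ u : Γ₀ˣ, (u : Γ₀) = v f ∧ u ∈ Δ then v f else 0

theorem horizontal_specialization
    {A : Type*} [CommRing A] {Γ₀ : Type*} [LinearOrderedCommGroupWithZero Γ₀]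
    (v : Valuation A Γ₀) (Δ : Subgroup Γ₀ˣ)
    (hΔle : Δ ≤ valueGroup v)
    (hconvex : ∀ γ ∈ valueGroup v, ∀ δ₁ ∈ Δ, ∀ δ₂ ∈ Δ, δ₁ ≤ γ → γ ≤ δ₂ → γ ∈ Δ)
    (hone : ∀ (f : A) (u : Γ₀ˣ), (u : Γ₀) = v f → (1 : Γ₀) ≤ v f → u ∈ Δ) :
    (∃ vΔ : Valuation A Γ₀, ∀ f : A, vΔ f = horizSpec v Δ f) ∧
      (∀ g s : A, horizSpec v Δ g ≤ horizSpec v Δ s → horizSpec v Δ s ≠ 0 →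
        v g ≤ v s ∧ v s ≠ 0) := by
  classical
  have hmem : ∀ (f : A) (u : Γ₀ˣ), (u : Γ₀) = v f → u ∈ valueGroup v := fun f u hu =>
    Subgroup.subset_closure ⟨f, hu.symm⟩
  have up : ∀ (f g : A), (∃ u : Γ₀ˣ, (u : Γ₀) = v f ∧ u ∈ Δ) → v f ≤ v g →
      ∃ u : Γ₀ˣ, (u : Γ₀) = v g ∧ u ∈ Δ := by
    rintro f g ⟨a, ha, haΔ⟩ hle
    have hg : v g ≠ 0 := by
      intro h
      rw [h, ← ha] at hle
      exact a.ne_zero (le_zero_iff.mp hle)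
    refine ⟨Units.mk0 (v g) hg, rfl, ?_⟩
    rcases le_total 1 (v g) with h | h
    · exact hone g _ rfl h
    · refine hconvex _ (hmem g _ rfl) a haΔ 1 Δ.one_mem ?_ ?_
      · rw [← Units.val_le_val, ha]; exact hle
      · rw [← Units.val_le_val]; exact h
  have hpos : ∀ f : A, (∃ u : Γ₀ˣ, (u : Γ₀) = v f ∧ u ∈ Δ) → horizSpec v Δ f = v f :=
    fun f h => if_pos h
  have hneg : ∀ f : A, (¬ ∃ u : Γ₀ˣ, (u : Γ₀) = v f ∧ u ∈ Δ) → horizSpec v Δ f = 0 :=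
    fun f h => if_neg h
  have left : ∀ f g : A, (∃ u : Γ₀ˣ, (u : Γ₀) = v (f * g) ∧ u ∈ Δ) →
      ∃ u : Γ₀ˣ, (u : Γ₀) = v f ∧ u ∈ Δ := by
    intro f g h
    rcases le_total (v g) 1 with hg | hg
    · refine up _ f h ?_
      rw [map_mul]
      exact mul_le_of_le_one_right' hg
    · obtain ⟨c, hc, hcΔ⟩ := h
      have hg0 : v g ≠ 0 := (lt_of_lt_of_le zero_lt_one hg).ne'
      refine ⟨c * (Units.mk0 (v g) hg0)⁻¹, ?_, Δ.mul_mem hcΔ (Δ.inv_mem (hone g _ rfl hg))⟩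
      rw [Units.val_mul, hc, map_mul, Units.val_inv_eq_inv_val, Units.val_mk0,
        mul_inv_cancel_right₀ hg0]
  refine ⟨⟨⟨⟨⟨horizSpec v Δ, ?_⟩, ?_, ?_⟩, ?_⟩, fun f => rfl⟩, ?_⟩
  · show horizSpec v Δ 0 = 0
    apply hneg
    rintro ⟨u, hu, -⟩
    rw [map_zero] at hu
    exact u.ne_zero hu
  · show horizSpec v Δ 1 = 1
    rw [hpos 1 ⟨1, by simp, Δ.one_mem⟩, map_one]
  · intro f g
    show horizSpec v Δ (f * g) = horizSpec v Δ f * horizSpec v Δ g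
    by_cases h : ∃ u : Γ₀ˣ, (u : Γ₀) = v (f * g) ∧ u ∈ Δ
    · rw [hpos _ h, hpos f (left f g h), hpos g (left g f (by rwa [mul_comm])), map_mul]
    · rw [hneg _ h]
      by_cases hf : ∃ u : Γ₀ˣ, (u : Γ₀) = v f ∧ u ∈ Δ
      · by_cases hg : ∃ u : Γ₀ˣ, (u : Γ₀) = v g ∧ u ∈ Δ
        · obtain ⟨a, ha, haΔ⟩ := hf
          obtain ⟨b, hb, hbΔ⟩ := hg
          exact absurd ⟨a * b, by rw [Units.val_mul, ha, hb, map_mul], Δ.mul_mem haΔ hbΔ⟩ h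
        · rw [hneg g hg, mul_zero]
      · rw [hneg f hf, zero_mul]
  · intro f g
    show horizSpec v Δ (f + g) ≤ max (horizSpec v Δ f) (horizSpec v Δ g)
    by_cases h : ∃ u : Γ₀ˣ, (u : Γ₀) = v (f + g) ∧ u ∈ Δ
    · rw [hpos _ h]
      rcases le_max_iff.mp (v.map_add f g) with h' | h'
      · exact le_max_of_le_left (by rwa [hpos f (up _ f h h')])
      · exact le_max_of_le_right (by rwa [hpos g (up _ g h h')])
    · rw [hneg _ h]
      exact zero_le
  · intro g s hle hs
    have h : ∃ u : Γ₀ˣ, (u : Γ₀) = v s ∧ u ∈ Δ := by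
      by_contra h
      exact hs (hneg s h)
    rw [hpos s h] at hle hs
    refine ⟨?_, hs⟩
    by_contra hlt
    rw [hpos g (up s g h (le_of_not_ge hlt))] at hle
    exact hlt hle
end

section
/- Every continuous valuation on the p-adic field ℚ_p (with its p-adic topology) is equivalent to the valuation given by the p-adic norm: if v : ℚ_p → Γ₀ is a continuous valuation, then for all f, g ∈ ℚ_p one has v(f) ≤ v(g) if and only if ‖f‖_p ≤ ‖g‖_p. -/
/-!
Statement 13: Every continuous valuation on `ℚ_p` is equivalent to the `p`-adic norm:
`v f ≤ v g ↔ ‖f‖_p ≤ ‖g‖_p`.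
-/

open Filter Topology

/-- A valuation on a topological ring is continuous if `{f | v f < γ}` is open for every
`γ` in the value group of `v`. -/
def IsContinuousVal {A : Type*} [CommRing A] [TopologicalSpace A]
    {Γ₀ : Type*} [LinearOrderedCommGroupWithZero Γ₀] (v : Valuation A Γ₀) : Prop :=
  ∀ γ ∈ valueGroup v, IsOpen {f : A | v f < (γ : Γ₀)}

theorem continuous_valuation_on_Qp_equiv_padic_norm
    (p : ℕ) [Fact p.Prime]
    {Γ₀ : Type*} [LinearOrderedCommGroupWithZero Γ₀]
    (v : Valuation ℚ_[p] Γ₀) (hv : IsContinuousVal v) :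
    ∀ f g : ℚ_[p], v f ≤ v g ↔ ‖f‖ ≤ ‖g‖ := by
  have hU : IsOpen {f : ℚ_[p] | v f < 1} := by
    simpa using hv 1 (one_mem _)
  have hlt : ∀ x : ℚ_[p], ‖x‖ < 1 → v x < 1 := by
    intro x hx
    have ht : Tendsto (fun n : ℕ => x ^ n) atTop (𝓝 0) :=
      tendsto_pow_atTop_nhds_zero_of_norm_lt_one hx
    have hev := ht.eventually (hU.mem_nhds (show (0 : ℚ_[p]) ∈ {f : ℚ_[p] | v f < 1} by simp))
    obtain ⟨n, hn⟩ := hev.exists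
    by_contra! h
    have h2 : v (x ^ n) < 1 := hn
    rw [map_pow] at h2
    exact absurd h2 (not_lt.mpr (one_le_pow₀ h))
  have hle : ∀ x : ℚ_[p], ‖x‖ ≤ 1 → v x ≤ 1 := by
    intro x hx
    have hnat : ∀ n : ℕ, v (n : ℚ_[p]) ≤ 1 := by
      intro n
      induction n with
      | zero => simp
      | succ k ih =>
        rw [Nat.cast_succ]
        exact v.map_add_le ih (by simp)
    have hopen : IsOpen {z : ℤ_[p] | v (x - (z : ℚ_[p])) < 1} :=
      hU.preimage (continuous_const.sub continuous_subtype_val)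
    obtain ⟨n, hn⟩ := (PadicInt.denseRange_natCast (p := p)).exists_mem_open hopen
      ⟨⟨x, hx⟩, show v (x - x) < 1 by simp⟩
    have h2 : v (x - (n : ℚ_[p])) < 1 := by simpa using hn
    have h3 := v.map_add_le h2.le (hnat n)
    simpa using h3
  intro f g
  by_cases hg : g = 0
  · subst hg
    simp
  have key : v (f / g) ≤ 1 ↔ ‖f / g‖ ≤ 1 := by
    refine ⟨fun h => ?_, hle _⟩
    by_contra! h1
    have h2 := hlt (f / g)⁻¹ (by rw [norm_inv]; exact inv_lt_one_of_one_lt₀ h1)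
    have h0 : f / g ≠ 0 := by
      intro h0
      rw [h0, norm_zero] at h1
      linarith
    have h3 : v ((f / g) * (f / g)⁻¹) < 1 := by
      rw [map_mul]
      exact lt_of_le_of_lt (mul_le_of_le_one_left' h) h2
    rw [mul_inv_cancel₀ h0, map_one] at h3
    exact lt_irrefl _ h3
  have hvg : 0 < v g := zero_lt_iff.mpr (v.ne_zero_iff.mpr hg)
  rw [map_div₀, norm_div, div_le_one₀ hvg, div_le_one₀ (norm_pos_iff.mpr hg)] at key
  exact key
end
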